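/- Let h : ℝ^d × (0,∞) → ℝ be smooth with h > 0, v : ℝ^d × (0,∞) → ℝ^d smooth with ∂_t h + div(h v) = 0, and z : ℝ^d → ℝ a fixed smooth bathymetry. Define w := −(1/2) h div v + (3/4) v·∇z. Then ∂_t(h w) + div(v h w) = (3/2) p̄, where p̄ := (1/3) h ḧ + (1/2) h k̇, ḣ := ∂_t h + v·∇h, ḧ := ∂_t ḣ + v·∇ḣ, and k̇ := ∂_t(v·∇z) + v·∇(v·∇z). -/

import Mathlib

noncomputable section
open scoped BigOperators

/-- Physical space `ℝ^d`. -/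
abbrev Spc (d : ℕ) := EuclideanSpace ℝ (Fin d)
/-- Space-time `ℝ^d × ℝ` (time is the second component). -/
abbrev SpT (d : ℕ) := Spc d × ℝ

/-- Time derivative `∂_t f`. -/
noncomputable def dT {d : ℕ} (f : SpT d → ℝ) (p : SpT d) : ℝ :=
  deriv (fun t => f (p.1, t)) p.2

/-- `i`-th spatial partial derivative `∂_i f` of a space-time function. -/
noncomputable def dX {d : ℕ} (i : Fin d) (f : SpT d → ℝ) (p : SpT d) : ℝ :=
  fderiv ℝ (fun x => f (x, p.2)) p.1 (EuclideanSpace.single i 1)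

/-- `i`-th spatial partial derivative `∂_i z` of a time-independent function. -/
noncomputable def dZ {d : ℕ} (i : Fin d) (z : Spc d → ℝ) (x : Spc d) : ℝ :=
  fderiv ℝ z x (EuclideanSpace.single i 1)

/-- Divergence `div u = ∑_i ∂_i u_i` of a vector field. -/
noncomputable def divF {d : ℕ} (u : SpT d → Spc d) (p : SpT d) : ℝ :=
  ∑ i, dX i (fun q => u q i) p

/-- Divergence `div (f v) = ∑_i ∂_i (v_i f)` of a scalar multiple of a vector field. -/
noncomputable def divSV {d : ℕ} (v : SpT d → Spc d) (f : SpT d → ℝ) (p : SpT d) : ℝ :=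
  ∑ i, dX i (fun q => v q i * f q) p

/-- Advection term `v·∇f`. -/
noncomputable def adv {d : ℕ} (v : SpT d → Spc d) (f : SpT d → ℝ) (p : SpT d) : ℝ :=
  ∑ i, v p i * dX i f p

/-- `v·∇z` for the (time-independent) bathymetry `z`. -/
noncomputable def advZ {d : ℕ} (v : SpT d → Spc d) (z : Spc d → ℝ) (p : SpT d) : ℝ :=
  ∑ i, v p i * dZ i z p.1

section Calculus

variable {d : ℕ} {f g : SpT d → ℝ} {v : SpT d → Spc d} {p : SpT d}

lemma dT_eq_fderiv (hf : DifferentiableAt ℝ f p) : dT f p = fderiv ℝ f p (0, 1) :=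
  (HasFDerivAt.comp_hasDerivAt p.2 (f := fun t : ℝ => (p.1, t)) hf.hasFDerivAt
    ((hasDerivAt_const p.2 p.1).prodMk (hasDerivAt_id p.2))).deriv

lemma dX_eq_fderiv (hf : DifferentiableAt ℝ f p) (i : Fin d) :
    dX i f p = fderiv ℝ f p (EuclideanSpace.single i 1, 0) := by
  have h := HasFDerivAt.comp p.1 (f := fun x : Spc d => (x, p.2)) hf.hasFDerivAt
    (hasFDerivAt_prodMk_left p.1 p.2)
  have h' : fderiv ℝ (fun x : Spc d => f (x, p.2)) p.1 = _ := h.fderiv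
  simp [dX, h']

lemma contDiff_dT (hf : ContDiff ℝ (⊤ : ℕ∞) f) : ContDiff ℝ (⊤ : ℕ∞) (dT f) := by
  rw [show dT f = _ from funext fun p => dT_eq_fderiv (hf.differentiable (by simp) p)]
  exact (hf.fderiv_right le_rfl).clm_apply contDiff_const

lemma contDiff_dX (hf : ContDiff ℝ (⊤ : ℕ∞) f) (i : Fin d) : ContDiff ℝ (⊤ : ℕ∞) (dX i f) := by
  rw [show dX i f = _ from funext fun p => dX_eq_fderiv (hf.differentiable (by simp) p) i]
  exact (hf.fderiv_right le_rfl).clm_apply contDiff_const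

lemma contDiff_coord (hv : ContDiff ℝ (⊤ : ℕ∞) v) (i : Fin d) :
    ContDiff ℝ (⊤ : ℕ∞) (fun q => v q i) :=
  contDiff_euclidean.1 hv i

lemma contDiff_adv (hv : ContDiff ℝ (⊤ : ℕ∞) v) (hf : ContDiff ℝ (⊤ : ℕ∞) f) :
    ContDiff ℝ (⊤ : ℕ∞) (adv v f) :=
  ContDiff.sum fun i _ => (contDiff_coord hv i).mul (contDiff_dX hf i)

lemma contDiff_advZ {z : Spc d → ℝ} (hv : ContDiff ℝ (⊤ : ℕ∞) v)
    (hz : ContDiff ℝ (⊤ : ℕ∞) z) : ContDiff ℝ (⊤ : ℕ∞) (advZ v z) :=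
  ContDiff.sum fun i _ => (contDiff_coord hv i).mul
    (((hz.fderiv_right le_rfl).clm_apply contDiff_const).comp contDiff_fst)

/-- The material derivative is the derivative along the space-time velocity `(v, 1)`. -/
lemma dT_add_adv_eq_fderiv (hf : DifferentiableAt ℝ f p) :
    dT f p + adv v f p = fderiv ℝ f p (v p, 1) := by
  have hvp : ((v p, 1) : SpT d)
      = (0, 1) + ∑ i, v p i • ((EuclideanSpace.single i 1, 0) : SpT d) := by
    refine Prod.ext ?_ ?_
    · ext j
      simp [Prod.fst_sum, Pi.single_apply]
    · simp [Prod.snd_sum]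
  rw [hvp, map_add, map_sum, dT_eq_fderiv hf]
  simp only [adv, dX_eq_fderiv hf, map_smul, smul_eq_mul]

lemma divSV_eq (hv : ∀ i, DifferentiableAt ℝ (fun q => v q i) p) (hf : DifferentiableAt ℝ f p) :
    divSV v f p = adv v f p + f p * divF v p := by
  simp only [divSV, adv, divF, Finset.mul_sum, ← Finset.sum_add_distrib]
  refine Finset.sum_congr rfl fun i _ => ?_
  rw [dX_eq_fderiv ((hv i).fun_mul hf), dX_eq_fderiv (hv i), dX_eq_fderiv hf,
    fderiv_fun_mul (hv i) hf]
  simp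

/-- A quantity transported in conservative form, split into mass balance and advection. -/
lemma dT_mul_add_divSV_mul (hv : ∀ i, DifferentiableAt ℝ (fun q => v q i) p)
    (hf : DifferentiableAt ℝ f p) (hg : DifferentiableAt ℝ g p) :
    dT (fun q => f q * g q) p + divSV v (fun q => f q * g q) p
      = g p * (dT f p + divSV v f p) + f p * (dT g p + adv v g p) := by
  rw [divSV_eq hv (hf.fun_mul hg), divSV_eq hv hf, ← add_assoc, ← add_assoc,
    dT_add_adv_eq_fderiv (hf.fun_mul hg), dT_add_adv_eq_fderiv hf, dT_add_adv_eq_fderiv hg,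
    fderiv_fun_mul hf hg]
  simp
  ring

end Calculus

/-- Under mass conservation, `w := -(1/2) h div v + (3/4) v·∇z` satisfies
`∂_t(h w) + div(v h w) = (3/2) p̄` with `p̄ := (1/3) h ḧ + (1/2) h k̇`. -/
theorem sgn_alternative_reformulation_identity
    {d : ℕ} (h : SpT d → ℝ) (v : SpT d → Spc d) (z : Spc d → ℝ)
    (hsm : ContDiff ℝ (⊤ : ℕ∞) h) (vsm : ContDiff ℝ (⊤ : ℕ∞) v) (zsm : ContDiff ℝ (⊤ : ℕ∞) z)
    (hpos : ∀ p : SpT d, 0 < h p)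
    (mass : ∀ p : SpT d, 0 < p.2 → dT h p + divSV v h p = 0)
    (hdot : SpT d → ℝ) (hhdot : ∀ p, hdot p = dT h p + adv v h p)
    (hddot : SpT d → ℝ) (hhddot : ∀ p, hddot p = dT hdot p + adv v hdot p)
    (kdot : SpT d → ℝ)
    (hkdot : ∀ p, kdot p = dT (fun q => advZ v z q) p + adv v (fun q => advZ v z q) p)
    (w : SpT d → ℝ) (hw : ∀ p, w p = -(1/2) * h p * divF v p + (3/4) * advZ v z p)
    (pbar : SpT d → ℝ) (hpbar : ∀ p, pbar p = (1/3) * h p * hddot p + (1/2) * h p * kdot p) :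
    ∀ p : SpT d, 0 < p.2 →
      dT (fun q => h q * w q) p + divSV v (fun q => h q * w q) p = (3/2) * pbar p := by
  intro p hp
  have vd : ∀ q i, DifferentiableAt ℝ (fun q => v q i) q :=
    fun q i => (contDiff_coord vsm i).differentiable (by simp) q
  have hd : Differentiable ℝ h := hsm.differentiable (by simp)
  have kd : Differentiable ℝ (advZ v z) := (contDiff_advZ vsm zsm).differentiable (by simp)
  have hdotd : Differentiable ℝ hdot := by
    rw [funext hhdot]
    exact ((contDiff_dT hsm).add (contDiff_adv vsm hsm)).differentiable (by simp)
  have hw_near : w =ᶠ[nhds p] fun q => (1/2) * hdot q + (3/4) * advZ v z q := by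
    filter_upwards [continuous_snd.continuousAt.eventually (lt_mem_nhds hp)] with q hq
    have hm := mass q hq
    rw [divSV_eq (vd q) (hd q)] at hm
    rw [hw, hhdot]
    linear_combination (-1/2) * hm
  have wd : DifferentiableAt ℝ w p :=
    hw_near.differentiableAt_iff.2
      (((hdotd p).const_mul _).fun_add ((kd p).const_mul _))
  rw [dT_mul_add_divSV_mul (vd p) (hd p) wd, mass p hp, hpbar, hhddot, hkdot,
    dT_add_adv_eq_fderiv wd, dT_add_adv_eq_fderiv (hdotd p), dT_add_adv_eq_fderiv (kd p),
    hw_near.fderiv_eq, fderiv_fun_add ((hdotd p).const_mul _) ((kd p).const_mul _),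
    fderiv_const_mul (hdotd p), fderiv_const_mul (kd p)]
  simp
  ring
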